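/- For every θ ∈ (0,1) there exist constants C = C(θ) > 0 and δ₀ = δ₀(θ) > 0 with the following property. Let I ⊆ ℝ be an open interval, ψ : I → ℝ a 1-convex function such that m := e^{-ψ} dx (extended by 0 outside I) is a probability measure, and suppose there are r ∈ I and 0 < δ ≤ δ₀ with m((-∞, r] ∩ I) = θ, |r − a_θ| ≤ 1, and e^{-ψ(r)} ≤ (2π)^{−1/2} e^{−a_θ²/2} + δ. Then, with f(x) = e^{ψ_g(x) − ψ(x)} for x ∈ I and f(x) = 0 for x ∉ I, one has ∫_ℝ |f(x) − 1| γ(dx) ≤ C·δ + 2|a_θ − r|/√(2π). -/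

import Mathlib

open MeasureTheory Real Set

/-- `gaussPsi x = x²/2 + (1/2)·log(2π)`, so that the standard Gaussian measure
is `exp (-gaussPsi x) dx`. -/
noncomputable def gaussPsi (x : ℝ) : ℝ := x ^ 2 / 2 + Real.log (2 * π) / 2

/-- The standard Gaussian measure `γ(dx) = (2π)^{-1/2} exp(-x²/2) dx` on `ℝ`. -/
noncomputable def gauss : Measure ℝ :=
  MeasureTheory.volume.withDensity fun x => ENNReal.ofReal (Real.exp (-gaussPsi x))


/-- Gaussian density. -/
noncomputable def nphi (x : ℝ) : ℝ := Real.exp (-gaussPsi x)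

lemma nphi_eq (x : ℝ) : nphi x = ProbabilityTheory.gaussianPDFReal 0 1 x := by
  have h2 : (0:ℝ) < 2 * π := by positivity
  unfold nphi gaussPsi ProbabilityTheory.gaussianPDFReal
  rw [neg_add, Real.exp_add, mul_comm]
  congr 1
  · rw [Real.exp_neg, Real.exp_half, Real.exp_log h2]; simp
  · congr 1; simp; ring

lemma nphi_eq' (x : ℝ) : nphi x = (2 * π) ^ (-(1:ℝ) / 2) * Real.exp (-x ^ 2 / 2) := by
  have h2 : (0:ℝ) < 2 * π := by positivity
  rw [Real.rpow_def_of_pos h2, ← Real.exp_add]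
  unfold nphi gaussPsi
  congr 1; ring

lemma nphi_pos (x : ℝ) : 0 < nphi x := Real.exp_pos _

lemma nphi_cont : Continuous nphi := by unfold nphi gaussPsi; fun_prop

lemma nphi_int : Integrable nphi := by
  have : nphi = ProbabilityTheory.gaussianPDFReal 0 1 := funext nphi_eq
  rw [this]; exact ProbabilityTheory.integrable_gaussianPDFReal 0 1

lemma nphi_integral : ∫ x, nphi x = 1 := by
  have : nphi = ProbabilityTheory.gaussianPDFReal 0 1 := funext nphi_eq
  rw [this]; exact ProbabilityTheory.integral_gaussianPDFReal_eq_one 0 one_ne_zero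

lemma nphi_le (x : ℝ) : nphi x ≤ 1 / Real.sqrt (2 * π) := by
  have h2 : (0:ℝ) < 2 * π := by positivity
  rw [nphi_eq]
  unfold ProbabilityTheory.gaussianPDFReal
  simp only [NNReal.coe_one, mul_one, sub_zero, one_div]
  have : Real.exp (-x^2/2) ≤ 1 := by
    rw [Real.exp_le_one_iff]; nlinarith [sq_nonneg x]
  calc _ ≤ (√(2*π))⁻¹ * 1 := by gcongr
    _ = _ := mul_one _

lemma nphi_exp_int (b c : ℝ) : Integrable (fun t => nphi (b + t) * Real.exp (c * t)) := by
  have h := (nphi_int.comp_add_left (b - c)).mul_const (Real.exp (c^2/2 - b * c))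
  refine h.congr (Filter.Eventually.of_forall fun t => ?_)
  simp only [nphi, gaussPsi, ← Real.exp_add]
  congr 1; ring

lemma nphi_abs_int (b : ℝ) : Integrable (fun t => nphi (b + t) * Real.exp (2 + 2 * |t|)) := by
  have h := ((nphi_exp_int b 2).add (nphi_exp_int b (-2))).const_mul (Real.exp 2)
  refine h.mono' ?_ (Filter.Eventually.of_forall fun t => ?_)
  · apply Continuous.aestronglyMeasurable
    have := nphi_cont
    fun_prop
  · have hp := nphi_pos (b + t)
    rw [Real.norm_of_nonneg (by positivity), Real.exp_add]
    have : Real.exp (2 * |t|) ≤ Real.exp (2 * t) + Real.exp (-2 * t) := by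
      rcases abs_cases t with ⟨h, _⟩ | ⟨h, _⟩
      · rw [h]; linarith [Real.exp_pos (-2 * t)]
      · rw [h]
        have : 2 * -t = -2 * t := by ring
        rw [this]; linarith [Real.exp_pos (2 * t)]
    simp only [Pi.add_apply]
    calc _ = Real.exp 2 * (nphi (b + t) * Real.exp (2 * |t|)) := by ring
      _ ≤ Real.exp 2 * (nphi (b + t) * (Real.exp (2 * t) + Real.exp (-2 * t))) := by gcongr
      _ = _ := by ring

lemma core (b : ℝ) : ∃ C : ℝ, 0 < C ∧ ∃ ε₀ : ℝ, 0 < ε₀ ∧ ∀ ε, 0 < ε → ε ≤ ε₀ →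
    ∀ (s : ℝ) (H : ℝ → ℝ), 0 ≤ s → Integrable H → 
    (∀ t, H t ≤ nphi (b + t) * Real.exp (ε - s * t)) →
    (∫ t in Ioi 0, H t) = ∫ t in Ioi 0, nphi (b + t) → (∫ t, H t) = 1 →
    (∫ t, |H t - nphi (b + t)|) ≤ C * ε := by
  set G : ℝ → ℝ := fun t => nphi (b + t) with hG
  have hGc : Continuous G := nphi_cont.comp (by fun_prop)
  have hGp : ∀ t, 0 < G t := fun t => nphi_pos _
  have hGi : Integrable G := nphi_int.comp_add_left b
  have hG1 : ∫ t, G t = 1 := by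
    rw [hG, integral_add_left_eq_self nphi b, nphi_integral]
  have hKi : IntegrableOn (fun t => G t * (1 - Real.exp (-t))) (Ioi 0) := by
    have := (hGi.sub (nphi_exp_int b (-1))).integrableOn (s := Ioi 0)
    refine this.congr (Filter.Eventually.of_forall fun t => ?_)
    simp [hG]; ring
  set K := ∫ t in Ioi 0, G t * (1 - Real.exp (-t)) with hK
  have hKpos : 0 < K := by
    rw [hK, setIntegral_pos_iff_support_of_nonneg_ae _ hKi]
    · have : Function.support (fun t => G t * (1 - Real.exp (-t))) ∩ Ioi 0 = Ioi 0 := by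
        rw [inter_eq_right]
        intro t ht
        have : Real.exp (-t) < 1 := by rw [Real.exp_lt_one_iff]; simpa using ht
        exact (mul_pos (hGp t) (by linarith)).ne'
      rw [this]; simp
    · refine (ae_restrict_iff' measurableSet_Ioi).2 (Filter.Eventually.of_forall fun t ht => ?_)
      have : Real.exp (-t) < 1 := by rw [Real.exp_lt_one_iff]; simpa using ht
      exact (mul_pos (hGp t) (by linarith)).le
  set M := ∫ t, G t * Real.exp (2 + 2 * |t|) with hM
  have hMi : Integrable (fun t => G t * Real.exp (2 + 2 * |t|)) := nphi_abs_int b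
  have hM0 : 0 ≤ M := integral_nonneg fun t => by have := hGp t; positivity
  refine ⟨2 * (1 + 1 / K) * (M + 1), by positivity, min 1 (K / 2), by positivity, ?_⟩
  intro ε hε hεle s H hs hHi hHle hHIoi hH1
  have hε1 : ε ≤ 1 := hεle.trans (min_le_left _ _)
  have hεK : ε ≤ K / 2 := hεle.trans (min_le_right _ _)
  -- bound on s
  have hs' : min s 1 * K ≤ ε := by
    set s' := min s 1 with hs'
    have hs0 : 0 ≤ s' := le_min hs zero_le_one
    have hs1 : s' ≤ 1 := min_le_right _ _
    have hss : s' ≤ s := min_le_left _ _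
    have h1 : ∫ t in Ioi 0, H t ≤ 
        ∫ t in Ioi 0, Real.exp ε * (G t - s' * (G t * (1 - Real.exp (-t)))) := by
      refine setIntegral_mono_on hHi.integrableOn
        ((hGi.integrableOn.sub (hKi.const_mul s')).const_mul _) measurableSet_Ioi ?_
      intro t ht
      have ht0 : (0:ℝ) < t := ht
      have hc : Real.exp (-(s' * t)) ≤ 1 - s' * (1 - Real.exp (-t)) := by
        have := convexOn_exp.2 (mem_univ (0:ℝ)) (mem_univ (-t)) (sub_nonneg.2 hs1) hs0 (by ring)
        simp only [smul_eq_mul, mul_zero, zero_add, Real.exp_zero, mul_one] at this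
        rw [mul_neg] at this
        linarith
      calc H t ≤ G t * Real.exp (ε - s * t) := hHle t
        _ ≤ G t * Real.exp (ε + -(s' * t)) := by
            have := hGp t
            gcongr
            nlinarith
        _ = Real.exp ε * (G t * Real.exp (-(s' * t))) := by rw [Real.exp_add]; ring
        _ ≤ Real.exp ε * (G t * (1 - s' * (1 - Real.exp (-t)))) := by
            have := hGp t
            gcongr
        _ = _ := by ring
    rw [integral_const_mul, integral_sub hGi.integrableOn (hKi.const_mul s'), integral_const_mul,
      ← hK, hHIoi] at h1
    have hle1 : ∫ t in Ioi 0, G t ≤ 1 := by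
      rw [← hG1]
      exact setIntegral_le_integral hGi (Filter.Eventually.of_forall fun t => (hGp t).le)
    have hge0 : 0 ≤ ∫ t in Ioi 0, G t := integral_nonneg fun t => (hGp t).le
    set A := ∫ t in Ioi 0, G t
    change A ≤ _ at h1
    have he : 1 - ε ≤ Real.exp (-ε) := by linarith [Real.add_one_le_exp (-ε)]
    have h2 : Real.exp (-ε) * A ≤ A - s' * K := by
      calc _ ≤ Real.exp (-ε) * (Real.exp ε * (A - s' * K)) := by gcongr
        _ = _ := by rw [← mul_assoc, ← Real.exp_add]; simp
    nlinarith
  have hsle : s ≤ 1 ∧ s * K ≤ ε := by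
    rcases le_total s 1 with h | h
    · rw [min_eq_left h] at hs'; exact ⟨h, hs'⟩
    · rw [min_eq_right h] at hs'; linarith
  obtain ⟨hs1, hsK⟩ := hsle
  have hsK' : s ≤ ε * (1 / K) := by
    rw [mul_one_div, le_div_iff₀ hKpos]; exact hsK
  -- main
  set c := ε * (1 + 1 / K) with hc
  have hc0 : 0 ≤ c := by positivity
  have hE : ∀ t, H t ≤ G t + c * (G t * Real.exp (2 + 2 * |t|)) := by
    intro t
    have hg := hGp t
    have hy : ε - s * t ≤ ε + s * |t| := by nlinarith [neg_abs_le t]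
    set y := ε + s * |t| with hydef
    have hy0 : 0 ≤ y := by positivity
    have hta := abs_nonneg t
    have hy1 : y ≤ 1 + |t| := by nlinarith
    have hyc : y ≤ c * (1 + |t|) := by
      have h1 : s * |t| ≤ ε * (1 / K) * |t| := by gcongr
      have h2 : 0 ≤ ε * (1 / K) := by positivity
      have h3 : 0 ≤ ε * |t| := by positivity
      rw [hydef, hc]; nlinarith
    have hexp : Real.exp y ≤ 1 + y * Real.exp y := by
      have h1 : 1 - y ≤ Real.exp (-y) := by linarith [Real.add_one_le_exp (-y)]
      have h2 : (1 - y) * Real.exp y ≤ Real.exp (-y) * Real.exp y := by gcongr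
      rw [← Real.exp_add, neg_add_cancel, Real.exp_zero] at h2
      linarith
    have h5 : 1 + |t| ≤ Real.exp (1 + |t|) := by linarith [Real.add_one_le_exp (1 + |t|)]
    have h6 : y * Real.exp y ≤ c * Real.exp (2 + 2 * |t|) := by
      calc y * Real.exp y ≤ (c * Real.exp (1 + |t|)) * Real.exp (1 + |t|) := by
            have : y ≤ c * Real.exp (1 + |t|) := hyc.trans (by gcongr)
            gcongr
        _ = _ := by rw [mul_assoc, ← Real.exp_add]; ring_nf
    calc H t ≤ G t * Real.exp (ε - s * t) := hHle t
      _ ≤ G t * Real.exp y := by gcongr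
      _ ≤ G t * (1 + c * Real.exp (2 + 2 * |t|)) := by
          gcongr; linarith
      _ = _ := by ring
  have hfin : ∫ t, |H t - G t| ≤ ∫ t, (2 * c * (G t * Real.exp (2 + 2 * |t|)) - (H t - G t)) := by
    refine integral_mono (hHi.sub hGi).abs ((hMi.const_mul _).sub (hHi.sub hGi)) ?_
    intro t
    have h1 := hE t
    have h2 : 0 ≤ c * (G t * Real.exp (2 + 2 * |t|)) := by have := hGp t; positivity
    simp only
    rcases abs_cases (H t - G t) with ⟨h, _⟩ | ⟨h, _⟩ <;> rw [h] <;> linarith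
  have hrhs : ∫ t, (2 * c * (G t * Real.exp (2 + 2 * |t|)) - (H t - G t)) = 2 * c * M := by
    have e1 : ∫ t, (H t - G t) = 0 := by rw [integral_sub hHi hGi, hH1, hG1]; simp
    have e2 := integral_sub (hMi.const_mul (2 * c)) (hHi.sub hGi)
    simp only [Pi.sub_apply] at e2
    rw [e2, e1, integral_const_mul, sub_zero]
  calc ∫ t, |H t - G t| ≤ 2 * c * M := hfin.trans hrhs.le
    _ ≤ 2 * c * (M + 1) := by gcongr; linarith
    _ = _ := by rw [hc]; ring

lemma core2 (b : ℝ) : ∃ C : ℝ, 0 < C ∧ ∃ ε₀ : ℝ, 0 < ε₀ ∧ ∀ ε, 0 < ε → ε ≤ ε₀ →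
    ∀ (s : ℝ) (H : ℝ → ℝ), Integrable H → 
    (∀ t, H t ≤ nphi (b + t) * Real.exp (ε - s * t)) →
    (∫ t in Iic 0, H t) = ∫ t in Iic 0, nphi (b + t) → (∫ t, H t) = 1 →
    (∫ t, |H t - nphi (b + t)|) ≤ C * ε := by
  obtain ⟨C₁, hC₁, e₁, he₁, h₁⟩ := core b
  obtain ⟨C₂, hC₂, e₂, he₂, h₂⟩ := core (-b)
  refine ⟨C₁ + C₂, by positivity, min e₁ e₂, by positivity, ?_⟩
  intro ε hε hεle s H hHi hHle hHI hH1
  have hGi : Integrable (fun t => nphi (b + t)) := nphi_int.comp_add_left b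
  have hG1 : ∫ t, nphi (b + t) = 1 := by
    rw [integral_add_left_eq_self nphi b, nphi_integral]
  have heven : ∀ t, nphi (-b + t) = nphi (b + -t) := by
    intro t; simp only [nphi, gaussPsi]; congr 1; ring
  rcases le_total 0 s with hs | hs
  · refine (h₁ ε hε (hεle.trans (min_le_left _ _)) s H hs hHi hHle ?_ hH1).trans ?_
    · have e1 := integral_add_compl (measurableSet_Iic (a := (0:ℝ))) hHi
      have e2 := integral_add_compl (measurableSet_Iic (a := (0:ℝ))) hGi
      rw [compl_Iic] at e1 e2
      linarith
    · nlinarith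
  · have := h₂ ε hε (hεle.trans (min_le_right _ _)) (-s) (fun t => H (-t)) (by linarith)
      hHi.comp_neg ?_ ?_ ?_
    · simp only [heven] at this
      rw [integral_neg_eq_self (fun t => |H t - nphi (b + t)|)] at this
      nlinarith
    · intro t
      rw [heven]
      have := hHle (-t)
      rwa [mul_neg, ← neg_mul] at this
    · simp only [heven]
      rw [integral_comp_neg_Ioi 0 H, integral_comp_neg_Ioi 0 (fun t => nphi (b + t)), neg_zero]
      exact hHI
    · rw [integral_neg_eq_self H]; exact hH1

lemma shift_Iic (f : ℝ → ℝ) (r c : ℝ) : ∫ t in Iic c, f (r + t) = ∫ x in Iic (r + c), f x := by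
  have := (measurePreserving_add_left volume r).setIntegral_preimage_emb
    (measurableEmbedding_addLeft r) f (Iic (r + c))
  rw [← this]
  congr 2
  ext t; simp

lemma tv_pos (q : ℝ) (hq : 0 ≤ q) :
    ∫ x, |nphi (q + x) - nphi x| ≤ 2 * q / Real.sqrt (2 * π) := by
  have hGi : Integrable (fun t => nphi (q + t)) := nphi_int.comp_add_left q
  have hd : Integrable (fun x => |nphi (q + x) - nphi x|) := (hGi.sub nphi_int).abs
  have hG1 : ∫ t, nphi (q + t) = 1 := by
    rw [integral_add_left_eq_self nphi q, nphi_integral]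
  rw [← integral_add_compl (measurableSet_Iic (a := -q/2)) hd]
  have e1 : ∫ x in Iic (-q/2), |nphi (q + x) - nphi x|
      = ∫ x in Iic (-q/2), (nphi (q + x) - nphi x) := by
    refine setIntegral_congr_fun measurableSet_Iic fun x hx => ?_
    have hx' : x ≤ -q/2 := hx
    refine abs_of_nonneg (sub_nonneg.2 ?_)
    simp only [nphi, gaussPsi]
    rw [Real.exp_le_exp]
    nlinarith
  have e2 : ∫ x in (Iic (-q/2))ᶜ, |nphi (q + x) - nphi x|
      = ∫ x in (Iic (-q/2))ᶜ, -(nphi (q + x) - nphi x) := by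
    refine setIntegral_congr_fun measurableSet_Iic.compl fun x hx => ?_
    have hx' : -q/2 < x := by simpa using hx
    refine abs_of_nonpos (sub_nonpos.2 ?_)
    simp only [nphi, gaussPsi]
    rw [Real.exp_le_exp]
    nlinarith
  have e3 := integral_add_compl (measurableSet_Iic (a := -q/2)) (hGi.sub nphi_int)
  have e4 : ∫ x, ((fun t => nphi (q + t)) - nphi) x = 0 := by
    simp only [Pi.sub_apply]
    rw [integral_sub hGi nphi_int, hG1, nphi_integral]; simp
  rw [e4] at e3
  simp only [Pi.sub_apply] at e3
  rw [e1, e2, integral_neg]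
  have e5 : ∫ x in Iic (-q/2), (nphi (q + x) - nphi x) = ∫ x in (-q/2)..(q/2), nphi x := by
    rw [integral_sub hGi.integrableOn nphi_int.integrableOn, shift_Iic,
      intervalIntegral.integral_Iic_sub_Iic nphi_int.integrableOn nphi_int.integrableOn]
    congr 1; ring
  have e6 : ∫ x in (-q/2)..(q/2), nphi x ≤ ∫ x in (-q/2)..(q/2), 1 / Real.sqrt (2 * π) :=
    intervalIntegral.integral_mono_on (by linarith) (nphi_cont.intervalIntegrable _ _) (by simp)
      fun x _ => nphi_le x
  rw [intervalIntegral.integral_const, smul_eq_mul] at e6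
  have e7 : (q / 2 - -q / 2) * (1 / √(2 * π)) = q / √(2*π) := by ring
  rw [e7] at e6
  have e8 : 2 * q / √(2 * π) = 2 * (q / √(2*π)) := by ring
  rw [e8]
  linarith

lemma tv (q : ℝ) : ∫ x, |nphi (q + x) - nphi x| ≤ 2 * |q| / Real.sqrt (2 * π) := by
  rcases le_total 0 q with hq | hq
  · rw [abs_of_nonneg hq]; exact tv_pos q hq
  · rw [abs_of_nonpos hq]
    refine le_trans (le_of_eq ?_) (tv_pos (-q) (by linarith))
    rw [← integral_add_left_eq_self (fun x => |nphi (-q + x) - nphi x|) q]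
    simp only [neg_add_cancel_left]
    exact integral_congr_ae (Filter.Eventually.of_forall fun x => abs_sub_comm _ _)

lemma gauss_Iic (a : ℝ) : gauss (Iic a) = ENNReal.ofReal (∫ x in Iic a, nphi x) := by
  rw [gauss, withDensity_apply _ measurableSet_Iic,
    ofReal_integral_eq_lintegral_ofReal nphi_int.integrableOn
      (Filter.Eventually.of_forall fun x => (nphi_pos x).le)]
  rfl

lemma Iic_strictMono : StrictMono (fun a => ∫ x in Iic a, nphi x) := by
  intro a b hab
  have h := intervalIntegral.integral_Iic_sub_Iic (a := a) (b := b)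
    nphi_int.integrableOn nphi_int.integrableOn
  have h2 := intervalIntegral.intervalIntegral_pos_of_pos
    (nphi_cont.intervalIntegrable a b) nphi_pos hab
  simp only
  linarith

lemma gauss_unique {a b : ℝ} (h : gauss (Iic a) = gauss (Iic b)) : a = b := by
  rw [gauss_Iic, gauss_Iic, ENNReal.ofReal_eq_ofReal_iff] at h
  · exact Iic_strictMono.injective h
  · exact integral_nonneg fun t => (nphi_pos t).le
  · exact integral_nonneg fun t => (nphi_pos t).le

lemma subgrad {S : Set ℝ} {f : ℝ → ℝ} (hf : ConvexOn ℝ S f) (hS : IsOpen S) {r : ℝ} (hr : r ∈ S) :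
    ∃ k, ∀ x ∈ S, f r + k * (x - r) ≤ f x := by
  have hri : r ∈ interior S := by rwa [hS.interior_eq]
  refine ⟨derivWithin f (Ioi r) r, fun x hx => ?_⟩
  rcases lt_trichotomy x r with h | h | h
  · have h1 := hf.slope_le_leftDeriv_of_mem_interior hx hri h
    have h2 := hf.leftDeriv_le_rightDeriv_of_mem_interior hri
    have h3 := h1.trans h2
    rw [slope_def_field, div_le_iff₀ (by linarith)] at h3
    linarith
  · simp [h]
  · have h1 := hf.rightDeriv_le_slope_of_mem_interior hri hx h
    rw [slope_def_field, le_div_iff₀ (by linarith)] at h1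
    linarith

lemma needle_convex {I : Set ℝ} {ψ : ℝ → ℝ} (hI : Convex ℝ I)
    (h : ∀ x ∈ I, ∀ y ∈ I, ∀ t ∈ Ioo (0:ℝ) 1,
          ψ ((1 - t) * x + t * y)
            ≤ (1 - t) * ψ x + t * ψ y - (1 / 2) * (1 - t) * t * |x - y| ^ 2) :
    ConvexOn ℝ I (fun x => ψ x - x ^ 2 / 2) := by
  rw [convexOn_iff_forall_pos]
  refine ⟨hI, fun x hx y hy u v hu hv huv => ?_⟩
  obtain rfl : u = 1 - v := by linarith
  have := h x hx y hy v ⟨hv, by linarith⟩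
  rw [sq_abs] at this
  simp only [smul_eq_mul]
  nlinarith

/-- the `L¹`-estimate for a single well-behaved needle, with centering
point `r` close to `a_θ` and isoperimetric deficit `δ` at `r`. -/
theorem l1_estimate_single_needle (θ : ℝ) (hθ : θ ∈ Ioo (0:ℝ) 1) :
    ∃ C : ℝ, 0 < C ∧ ∃ δ₀ : ℝ, 0 < δ₀ ∧
      ∀ (δ : ℝ), 0 < δ → δ ≤ δ₀ →
      ∀ (I : Set ℝ) (ψ : ℝ → ℝ) (a r : ℝ),
        IsOpen I → Convex ℝ I → r ∈ I →
        gauss (Iic a) = ENNReal.ofReal θ →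
        (∀ x ∈ I, ∀ y ∈ I, ∀ t ∈ Ioo (0:ℝ) 1,
          ψ ((1 - t) * x + t * y)
            ≤ (1 - t) * ψ x + t * ψ y - (1 / 2) * (1 - t) * t * |x - y| ^ 2) →
        IsProbabilityMeasure
          (MeasureTheory.volume.withDensity
            (I.indicator fun x => ENNReal.ofReal (Real.exp (-ψ x)))) →
        (MeasureTheory.volume.withDensity
            (I.indicator fun x => ENNReal.ofReal (Real.exp (-ψ x)))) (Iic r ∩ I)
          = ENNReal.ofReal θ →
        |r - a| ≤ 1 →
        Real.exp (-ψ r) ≤ (2 * π) ^ (-(1:ℝ) / 2) * Real.exp (-a ^ 2 / 2) + δ →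
        (∫ x, |I.indicator (fun y => Real.exp (gaussPsi y - ψ y)) x - 1| ∂gauss)
          ≤ C * δ + 2 * |a - r| / Real.sqrt (2 * π) := by
  by_cases hex : ∃ a, gauss (Iic a) = ENNReal.ofReal θ
  swap
  · refine ⟨1, one_pos, 1, one_pos, ?_⟩
    intro δ _ _ I ψ a r _ _ _ ha
    exact absurd ⟨a, ha⟩ hex
  obtain ⟨a₀, ha₀⟩ := hex
  obtain ⟨C, hC, ε₀, hε₀, hcore⟩ := core2 a₀
  have hp := nphi_pos a₀
  refine ⟨C / nphi a₀, by positivity, ε₀ * nphi a₀, by positivity, ?_⟩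
  intro δ hδ hδle I ψ a r hIo hIc hr ha hψ hprob hmr _ hdef
  obtain rfl : a = a₀ := gauss_unique (ha.trans ha₀.symm)
  have hconv := needle_convex hIc hψ
  obtain ⟨k, hk⟩ := subgrad hconv hIo hr
  have hψc : ContinuousOn ψ I := by
    have h1 := hconv.continuousOn hIo
    have h2 : ContinuousOn (fun x => (ψ x - x^2/2) + x^2/2) I := h1.add (by fun_prop)
    simpa using h2
  set h : ℝ → ℝ := I.indicator (fun x => Real.exp (-ψ x)) with hh
  have hh0 : ∀ x, 0 ≤ h x := fun x => indicator_nonneg (fun _ _ => (Real.exp_pos _).le) x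
  have hhm : Measurable h := by
    have hc : ContinuousOn (fun x => Real.exp (-ψ x)) I := by fun_prop
    classical
    have := hc.measurable_piecewise (continuousOn_const (c := (0:ℝ)) (s := Iᶜ)) hIo.measurableSet
    rw [hh, ← piecewise_eq_indicator]
    exact this
  have hdens : (I.indicator fun x => ENNReal.ofReal (Real.exp (-ψ x)))
      = fun x => ENNReal.ofReal (h x) := by
    funext x
    by_cases hx : x ∈ I <;> simp [hh, hx]
  rw [hdens] at hprob hmr
  have hl1 : ∫⁻ x, ENNReal.ofReal (h x) = 1 := by
    have := hprob.measure_univ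
    rwa [withDensity_apply _ MeasurableSet.univ, Measure.restrict_univ] at this
  have hhi : Integrable h := by
    refine ⟨hhm.aestronglyMeasurable, ?_⟩
    rw [hasFiniteIntegral_iff_ofReal (Filter.Eventually.of_forall hh0), hl1]
    exact ENNReal.one_lt_top
  have hh1 : ∫ x, h x = 1 := by
    rw [integral_eq_lintegral_of_nonneg_ae (Filter.Eventually.of_forall hh0)
      hhm.aestronglyMeasurable, hl1]; simp
  have hhr : ∫ x in Iic r, h x = θ := by
    have e : ∫ x in Iic r ∩ I, h x = θ := by
      rw [withDensity_apply _ (measurableSet_Iic.inter hIo.measurableSet)] at hmr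
      rw [integral_eq_lintegral_of_nonneg_ae (Filter.Eventually.of_forall hh0)
        hhm.aestronglyMeasurable, hmr, ENNReal.toReal_ofReal hθ.1.le]
    rw [← e, ← setIntegral_indicator hIo.measurableSet]
    congr 1
    funext x
    by_cases hx : x ∈ I <;> simp [hh, hx]
  have hga : ∫ x in Iic a, nphi x = θ := by
    rw [gauss_Iic, ENNReal.ofReal_eq_ofReal_iff _ hθ.1.le] at ha
    · exact ha
    · exact integral_nonneg fun t => (nphi_pos t).le
  -- apply the core estimate
  have hε : 0 < δ / nphi a := by positivity
  have hεle : δ / nphi a ≤ ε₀ := by rw [div_le_iff₀ hp]; exact hδle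
  have hdef' : Real.exp (-ψ r) ≤ nphi a * Real.exp (δ / nphi a) := by
    rw [← nphi_eq'] at hdef
    calc _ ≤ nphi a + δ := hdef
      _ = nphi a * (δ / nphi a + 1) := by field_simp; ring
      _ ≤ _ := by gcongr; exact Real.add_one_le_exp _
  have hmain := hcore (δ / nphi a) hε hεle (k + r - a) (fun t => h (r + t))
    (hhi.comp_add_left r) ?_ ?_ ?_
  rotate_left
  · intro t
    by_cases ht : r + t ∈ I
    · have h1 := hk _ ht
      simp only [hh, indicator_of_mem ht]
      calc Real.exp (-ψ (r + t)) ≤ Real.exp (-ψ r + (-(k * t) - r * t - t ^ 2 / 2)) := by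
            gcongr
            nlinarith
        _ = Real.exp (-ψ r) * Real.exp (-(k * t) - r * t - t ^ 2 / 2) := Real.exp_add _ _
        _ ≤ nphi a * Real.exp (δ / nphi a) * Real.exp (-(k * t) - r * t - t ^ 2 / 2) := by gcongr
        _ = nphi (a + t) * Real.exp (δ / nphi a - (k + r - a) * t) := by
            generalize δ / nphi a = ε
            simp only [nphi, gaussPsi, ← Real.exp_add]
            congr 1; ring
    · simp only [hh, indicator_of_notMem ht]
      have := nphi_pos (a + t)
      positivity
  · rw [shift_Iic h, shift_Iic nphi, add_zero, add_zero, hhr, hga]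
  · rw [integral_add_left_eq_self h r, hh1]
  have htrans : ∫ x, |h x - nphi ((a - r) + x)| ≤ C / nphi a * δ := by
    rw [← integral_add_left_eq_self _ r]
    have e : ∀ t, a - r + (r + t) = a + t := fun t => by ring
    simp only [e]
    calc _ ≤ _ := hmain
      _ = _ := by ring
  have hgoal : (∫ x, |I.indicator (fun y => Real.exp (gaussPsi y - ψ y)) x - 1| ∂gauss)
      = ∫ x, |h x - nphi x| := by
    have hm : Measurable (fun x => ENNReal.ofReal (Real.exp (-gaussPsi x))) :=
      (nphi_cont.measurable).ennreal_ofReal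
    rw [gauss, integral_withDensity_eq_integral_toReal_smul hm
      (Filter.Eventually.of_forall fun x => ENNReal.ofReal_lt_top)]
    refine integral_congr_ae (Filter.Eventually.of_forall fun x => ?_)
    simp only [smul_eq_mul]
    rw [ENNReal.toReal_ofReal (Real.exp_pos _).le]
    change nphi x * _ = _
    nth_rewrite 1 [← abs_of_pos (nphi_pos x)]
    rw [← abs_mul, mul_sub, mul_one]
    congr 2
    by_cases hx : x ∈ I
    · simp only [hh, indicator_of_mem hx, nphi, ← Real.exp_add]
      congr 1; ring
    · simp [hh, hx]
  rw [hgoal]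
  have hqi : Integrable (fun t => nphi ((a - r) + t)) := nphi_int.comp_add_left _
  have htv := tv (a - r)
  calc ∫ x, |h x - nphi x|
      ≤ ∫ x, (|h x - nphi ((a - r) + x)| + |nphi ((a - r) + x) - nphi x|) := by
        refine integral_mono (hhi.sub nphi_int).abs
          ((hhi.sub hqi).abs.add (hqi.sub nphi_int).abs) fun x => abs_sub_le _ _ _
    _ = (∫ x, |h x - nphi ((a - r) + x)|) + ∫ x, |nphi ((a - r) + x) - nphi x| :=
        integral_add (hhi.sub hqi).abs (hqi.sub nphi_int).abs
    _ ≤ _ := by linarith
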